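/- Let f(X) = a_0 + a_1 X + ... + a_n X^n be a polynomial with integer coefficients of degree n ≥ 1, and let a, b be two integers such that a² < b² and |a_n| > Σ_{i=0}^{n-1} |a_i| · (|a+b|/2)^{i−n}. Suppose |f(a)| = p^k and |f(b)| = p^k·r^j for two distinct prime numbers p, r and positive integers k, j with p^k > r^j, p ∤ f'(a)·f'(b) and r ∤ f'(b). Then f is irreducible over ℚ. -/

import Mathlib

open Polynomial

theorem Multiset.prod_map_lt_prod_map_of_nonneg {ι : Type*} {u v : ι → ℝ} {s : Multiset ι}
    (hs : s ≠ 0) (hu : ∀ i ∈ s, 0 ≤ u i) (h : ∀ i ∈ s, u i < v i) :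
    (s.map u).prod < (s.map v).prod := by
  induction s using Multiset.induction with
  | empty => exact absurd rfl hs
  | cons i s ih =>
    rcases eq_or_ne s 0 with rfl | hs'
    · simpa using h i
    · rw [Multiset.map_cons, Multiset.map_cons, Multiset.prod_cons, Multiset.prod_cons]
      refine mul_lt_mul'' (h i (Multiset.mem_cons_self i s))
        (ih hs' (fun j hj => hu j (Multiset.mem_cons_of_mem hj))
          fun j hj => h j (Multiset.mem_cons_of_mem hj))
        (hu i (Multiset.mem_cons_self i s)) (Multiset.prod_nonneg fun x hx => ?_)
      obtain ⟨j, hj, rfl⟩ := Multiset.mem_map.1 hx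
      exact hu j (Multiset.mem_cons_of_mem hj)

theorem Polynomial.norm_eval_lt_norm_eval_of_roots {P : ℂ[X]} (hP : 0 < P.natDegree) {x y : ℂ}
    (h : ∀ z, P.IsRoot z → ‖x - z‖ < ‖y - z‖) : ‖P.eval x‖ < ‖P.eval y‖ := by
  have hP0 : P ≠ 0 := ne_zero_of_natDegree_gt hP
  have hs : P.Splits := IsAlgClosed.splits P
  have key : ∀ w : ℂ, ‖P.eval w‖ = ‖P.leadingCoeff‖ * (P.roots.map fun z => ‖w - z‖).prod := by
    intro w
    rw [hs.eval_eq_prod_roots, norm_mul]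
    congr 1
    simpa [Multiset.map_map, Function.comp_def] using
      map_multiset_prod (normHom : ℂ →*₀ ℝ) (P.roots.map fun z => w - z)
  rw [key, key]
  refine mul_lt_mul_of_pos_left ?_ (norm_pos_iff.2 (leadingCoeff_ne_zero.2 hP0))
  refine Multiset.prod_map_lt_prod_map_of_nonneg ?_ (fun _ _ => norm_nonneg _)
    fun z hz => h z (isRoot_of_mem_roots hz)
  rw [← Multiset.card_pos, ← hs.natDegree_eq_card_roots]
  exact hP

theorem Polynomial.norm_lt_of_aeval_eq_zero {f : ℤ[X]} {A : ℝ} (hA : 0 < A)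
    (hlead : ((|f.leadingCoeff| : ℤ) : ℝ) >
      ∑ i ∈ Finset.range f.natDegree,
        ((|f.coeff i| : ℤ) : ℝ) * A ^ ((i : ℤ) - (f.natDegree : ℤ)))
    {z : ℂ} (hz : aeval z f = 0) : ‖z‖ < A := by
  by_contra! hle
  have hz0 : 0 < ‖z‖ := hA.trans_le hle
  rw [aeval_eq_sum_range, Finset.sum_range_succ, add_eq_zero_iff_eq_neg'] at hz
  have h1 : ((|f.leadingCoeff| : ℤ) : ℝ) * ‖z‖ ^ f.natDegree ≤
      ∑ i ∈ Finset.range f.natDegree, ((|f.coeff i| : ℤ) : ℝ) * ‖z‖ ^ i := by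
    calc ((|f.leadingCoeff| : ℤ) : ℝ) * ‖z‖ ^ f.natDegree
        = ‖f.coeff f.natDegree • z ^ f.natDegree‖ := by
          simp [zsmul_eq_mul]
      _ = ‖∑ i ∈ Finset.range f.natDegree, f.coeff i • z ^ i‖ := by rw [hz, norm_neg]
      _ ≤ ∑ i ∈ Finset.range f.natDegree, ‖f.coeff i • z ^ i‖ := norm_sum_le _ _
      _ = _ := by simp [zsmul_eq_mul]
  have h2 : ∑ i ∈ Finset.range f.natDegree, ((|f.coeff i| : ℤ) : ℝ) * ‖z‖ ^ i ≤
      (∑ i ∈ Finset.range f.natDegree,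
        ((|f.coeff i| : ℤ) : ℝ) * A ^ ((i : ℤ) - (f.natDegree : ℤ))) * ‖z‖ ^ f.natDegree := by
    rw [Finset.sum_mul]
    refine Finset.sum_le_sum fun i hi => ?_
    rw [mul_assoc]
    refine mul_le_mul_of_nonneg_left ?_ (by positivity)
    have hi' : i ≤ f.natDegree := (Finset.mem_range.1 hi).le
    obtain ⟨m, hm⟩ := Nat.exists_eq_add_of_le hi'
    have he : (i : ℤ) - (f.natDegree : ℤ) = -(m : ℤ) := by omega
    rw [he, hm, zpow_neg, zpow_natCast, pow_add, inv_mul_eq_div, le_div_iff₀ (by positivity)]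
    gcongr
  exact absurd (h1.trans h2) (not_le.2 (mul_lt_mul_of_pos_right hlead (by positivity)))

theorem Complex.norm_intCast_sub_lt_norm_intCast_sub {a b : ℤ} (hab : a ^ 2 < b ^ 2) {z : ℂ}
    (hz : ‖z‖ < ((|a + b| : ℤ) : ℝ) / 2) : ‖(a : ℂ) - z‖ < ‖(b : ℂ) - z‖ := by
  have hre : 2 * |z.re| < |(a : ℝ) + b| := by
    have := z.abs_re_le_norm
    push_cast at hz
    linarith
  have hpos : 0 < ((b : ℝ) - a) * (a + b) := by
    have : (a : ℝ) ^ 2 < (b : ℝ) ^ 2 := by exact_mod_cast hab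
    linarith
  have hba : 0 < |(b : ℝ) - a| := abs_pos.2 (left_ne_zero_of_mul hpos.ne')
  have h1 : 2 * (((b : ℝ) - a) * z.re) < ((b : ℝ) - a) * (a + b) := by
    calc 2 * (((b : ℝ) - a) * z.re) ≤ 2 * |((b : ℝ) - a) * z.re| := by
          linarith [le_abs_self (((b : ℝ) - a) * z.re)]
      _ = |(b : ℝ) - a| * (2 * |z.re|) := by rw [abs_mul]; ring
      _ < |(b : ℝ) - a| * |(a : ℝ) + b| := mul_lt_mul_of_pos_left hre hba
      _ = _ := by rw [← abs_mul, abs_of_pos hpos]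
  refine lt_of_pow_lt_pow_left₀ 2 (norm_nonneg _) ?_
  rw [Complex.sq_norm, Complex.sq_norm, Complex.normSq_apply, Complex.normSq_apply]
  simp only [Complex.sub_re, Complex.sub_im, Complex.intCast_re, Complex.intCast_im]
  linarith

theorem Polynomial.abs_eval_lt_abs_eval_of_dvd {f g : ℤ[X]} {a b : ℤ} (hab : a ^ 2 < b ^ 2)
    (hlead : ((|f.leadingCoeff| : ℤ) : ℝ) >
      ∑ i ∈ Finset.range f.natDegree,
        ((|f.coeff i| : ℤ) : ℝ) * (((|a + b| : ℤ) : ℝ) / 2) ^ ((i : ℤ) - (f.natDegree : ℤ)))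
    (hgf : g ∣ f) (hg : 0 < g.natDegree) : |g.eval a| < |g.eval b| := by
  have hA : 0 < ((|a + b| : ℤ) : ℝ) / 2 := by
    have : a + b ≠ 0 := fun h => by
      rw [eq_neg_of_add_eq_zero_left h, neg_sq] at hab
      exact lt_irrefl _ hab
    have : 0 < |a + b| := abs_pos.2 this
    positivity
  have hinj : Function.Injective (Int.castRingHom ℂ) := Int.cast_injective
  have h := norm_eval_lt_norm_eval_of_roots (P := g.map (Int.castRingHom ℂ))
    (by rwa [natDegree_map_eq_of_injective hinj]) (x := a) (y := b) fun z hz => by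
      refine Complex.norm_intCast_sub_lt_norm_intCast_sub hab (norm_lt_of_aeval_eq_zero hA hlead ?_)
      obtain ⟨q, rfl⟩ := hgf
      have : aeval z g = 0 := by
        rw [aeval_def, ← eval_map]
        exact hz
      rw [map_mul, this, zero_mul]
  rw [eval_intCast_map, eval_intCast_map] at h
  simp only [eq_intCast, Int.cast_id, Complex.norm_intCast] at h
  exact_mod_cast h

/-- A prime dividing the values of both factors at `x` divides the derivative of the product. -/
theorem Polynomial.dvd_eval_derivative_mul {R : Type*} [CommRing R] {g h : R[X]} {x q : R}
    (hg : q ∣ g.eval x) (hh : q ∣ h.eval x) : q ∣ (derivative (g * h)).eval x := by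
  rw [derivative_mul, eval_add, eval_mul, eval_mul]
  exact dvd_add (hh.mul_left _) (hg.mul_right _)

/-- If a prime power divides a product but the prime misses one factor, it divides the other. -/
theorem Prime.pow_dvd_or_pow_dvd_of_not_dvd_and {q x y : ℤ} (hq : Prime q) {m : ℕ}
    (hxy : q ^ m ∣ x * y) (h : ¬ (q ∣ x ∧ q ∣ y)) :
    (¬ q ∣ x ∧ q ^ m ∣ y) ∨ (¬ q ∣ y ∧ q ^ m ∣ x) := by
  by_cases hx : q ∣ x
  · exact .inr ⟨fun hy => h ⟨hx, hy⟩, hq.pow_dvd_of_dvd_mul_right m (fun hy => h ⟨hx, hy⟩) hxy⟩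
  · exact .inl ⟨hx, hq.pow_dvd_of_dvd_mul_left m hx hxy⟩

theorem statement_15 (f : Polynomial ℤ) (hdeg : 1 ≤ f.natDegree) (a b : ℤ)
    (hab : a ^ 2 < b ^ 2)
    (hlead : ((|f.leadingCoeff| : ℤ) : ℝ) >
      ∑ i ∈ Finset.range f.natDegree,
        ((|f.coeff i| : ℤ) : ℝ) * (((|a + b| : ℤ) : ℝ) / 2) ^ ((i : ℤ) - (f.natDegree : ℤ)))
    (p r : ℕ) (hp : p.Prime) (hr : r.Prime) (hpr : p ≠ r)
    (k j : ℕ) (hk : 1 ≤ k) (hj : 1 ≤ j)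
    (hgt : (r : ℤ) ^ j < (p : ℤ) ^ k)
    (hfa : |f.eval a| = (p : ℤ) ^ k)
    (hfb : |f.eval b| = (p : ℤ) ^ k * (r : ℤ) ^ j)
    (hpd : ¬ ((p : ℤ) ∣ f.derivative.eval a * f.derivative.eval b))
    (hrd : ¬ ((r : ℤ) ∣ f.derivative.eval b)) :
    Irreducible (Polynomial.map (Int.castRingHom ℚ) f) := by
  have hp' : Prime (p : ℤ) := Nat.prime_iff_prime_int.1 hp
  have hr' : Prime (r : ℤ) := Nat.prime_iff_prime_int.1 hr
  have hpda : ¬ (p : ℤ) ∣ f.derivative.eval a := fun h => hpd (h.mul_right _)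
  have hpdb : ¬ (p : ℤ) ∣ f.derivative.eval b := fun h => hpd (h.mul_left _)
  have hconst : ∀ c : ℤ, C c ∣ f → IsUnit c := by
    rintro c ⟨q, rfl⟩
    have hcop : IsCoprime (p : ℤ) c := (hp'.coprime_iff_not_dvd).2 fun h => hpda (by
      rw [derivative_C_mul, eval_C_mul]
      exact h.mul_right _)
    refine (hcop.pow_left (m := k)).isUnit_of_dvd' ?_ dvd_rfl
    rw [← hfa, dvd_abs, eval_C_mul]
    exact dvd_mul_right _ _
  have hunit : ∀ g : ℤ[X], g ∣ f → g.natDegree = 0 → IsUnit g := fun g hg h0 => by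
    rw [eq_C_of_natDegree_eq_zero h0] at hg ⊢
    exact (hconst _ hg).map C
  -- a nonconstant factor cannot absorb all of `p ^ k` at `a` when its cofactor is nonconstant
  have main : ∀ g h : ℤ[X], f = g * h → 0 < g.natDegree → 0 < h.natDegree →
      ¬ ((p : ℤ) ^ k ∣ h.eval a) := by
    intro g h hgh hg hh hpk
    have hga := abs_eval_lt_abs_eval_of_dvd hab hlead (hgh ▸ dvd_mul_right g h) hg
    have hha := abs_eval_lt_abs_eval_of_dvd hab hlead (hgh ▸ dvd_mul_left h g) hh
    have hb : |g.eval b| * |h.eval b| = (p : ℤ) ^ k * (r : ℤ) ^ j := by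
      rw [← hfb, hgh, eval_mul, abs_mul]
    have ha : |g.eval a| * |h.eval a| = (p : ℤ) ^ k := by
      rw [← hfa, hgh, eval_mul, abs_mul]
    have hpkpos : 0 < (p : ℤ) ^ k := pow_pos (by exact_mod_cast hp.pos) k
    have hrjpos : 0 < (r : ℤ) ^ j := pow_pos (by exact_mod_cast hr.pos) j
    have hha0 : 0 < |h.eval a| := by
      refine abs_pos.2 fun h0 => ?_
      rw [h0, abs_zero, mul_zero] at ha
      exact hpkpos.ne ha
    have hga0 : 0 < |g.eval a| := by
      refine abs_pos.2 fun h0 => ?_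
      rw [h0, abs_zero, zero_mul] at ha
      exact hpkpos.ne ha
    have hle : (p : ℤ) ^ k ≤ |h.eval a| := Int.le_of_dvd hha0 ((dvd_abs _ _).2 hpk)
    have hdvd : (p : ℤ) ^ k * (r : ℤ) ^ j ∣ g.eval b * h.eval b := by
      rw [← dvd_abs, abs_mul, hb]
    have hcop : IsCoprime ((p : ℤ) ^ k) ((r : ℤ) ^ j) :=
      (Nat.isCoprime_iff_coprime.2 ((Nat.coprime_primes hp hr).2 hpr)).pow
    have hP := hp'.pow_dvd_or_pow_dvd_of_not_dvd_and ((dvd_mul_right _ _).trans hdvd)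
      fun H => hpdb (hgh ▸ dvd_eval_derivative_mul H.1 H.2)
    have hR := hr'.pow_dvd_or_pow_dvd_of_not_dvd_and ((dvd_mul_left _ _).trans hdvd)
      fun H => hrd (hgh ▸ dvd_eval_derivative_mul H.1 H.2)
    have hle_of_dvd : ∀ {m x : ℤ}, 0 < |x| → m ∣ x → m ≤ |x| := fun hx hm =>
      Int.le_of_dvd hx ((dvd_abs _ _).2 hm)
    have hgb0 : 0 < |g.eval b| := hga0.trans hga
    have hhb0 : 0 < |h.eval b| := hha0.trans hha
    rcases hP with ⟨-, hP⟩ | ⟨-, hP⟩ <;> rcases hR with ⟨-, hR⟩ | ⟨-, hR⟩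
    · have := hle_of_dvd hhb0 (hcop.mul_dvd hP hR)
      nlinarith
    · have := hle_of_dvd hgb0 hR
      nlinarith
    · have := hle_of_dvd hgb0 hP
      nlinarith
    · have := hle_of_dvd hgb0 (hcop.mul_dvd hP hR)
      nlinarith
  refine (IsPrimitive.Int.irreducible_iff_irreducible_map_cast hconst).1 ⟨fun hu => ?_, ?_⟩
  · rw [natDegree_eq_zero_of_isUnit hu] at hdeg
    omega
  · intro g h hgh
    by_contra! hgh'
    have hg : 0 < g.natDegree := Nat.pos_of_ne_zero fun h0 =>
      hgh'.1 (hunit g (hgh ▸ dvd_mul_right g h) h0)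
    have hh : 0 < h.natDegree := Nat.pos_of_ne_zero fun h0 =>
      hgh'.2 (hunit h (hgh ▸ dvd_mul_left h g) h0)
    have hdvd : (p : ℤ) ^ k ∣ g.eval a * h.eval a := by
      rw [← eval_mul, ← hgh, ← dvd_abs, hfa]
    rcases hp'.pow_dvd_or_pow_dvd_of_not_dvd_and hdvd
      fun H => hpda (hgh ▸ dvd_eval_derivative_mul H.1 H.2) with ⟨-, H⟩ | ⟨-, H⟩
    · exact main g h hgh hg hh H
    · exact main h g (hgh.trans (mul_comm g h)) hh hg H
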